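/- Let m ≥ 1, let α₁,…,α_m > 0 and α = α₁+⋯+α_m, and suppose 𝒜_m^h := Ω_Q^{-m} ∫_{{(y₁,…,y_m) : (|y₁|_h²+⋯+|y_m|_h²)^{1/2} < 1}} ∏_{i=1}^m |y_i|_h^{-α_i} dy₁⋯dy_m < ∞. Then the operator norm of the m-linear Hardy operator 𝔥_m^h from H^∞_{α₁}(ℍⁿ)×⋯×H^∞_{α_m}(ℍⁿ) to H^∞_α(ℍⁿ) (the least constant C with ‖𝔥_m^h(f₁,…,f_m)‖_{H^∞_α} ≤ C ∏_{i=1}^m ‖f_i‖_{H^∞_{α_i}} for all f_i ∈ H^∞_{α_i}(ℍⁿ)) equals exactly 𝒜_m^h. -/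

import Mathlib

open MeasureTheory ENNReal

/-- The Korányi (homogeneous) norm on the Heisenberg group `ℍⁿ ≃ ℝ^{2n+1}`. -/
noncomputable def hnorm (n : ℕ) (x : Fin (2*n+1) → ℝ) : ℝ :=
  ((∑ i : Fin (2*n+1), if (i : ℕ) < 2*n then (x i)^2 else 0)^2
    + (x (Fin.last (2*n)))^2) ^ ((1:ℝ)/4)

/-- The Heisenberg dilations `δ_r`. -/
noncomputable def dil (n : ℕ) (r : ℝ) (x : Fin (2*n+1) → ℝ) : Fin (2*n+1) → ℝ :=
  fun i => if (i : ℕ) < 2*n then r * x i else r^2 * x i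

/-- The norm of the weighted-type space `H^∞_α(ℍⁿ)`:
`‖f‖ = ess sup_x |x|_h^α |f x|`. -/
noncomputable def wnorm (n : ℕ) (α : ℝ) (f : (Fin (2*n+1) → ℝ) → ℝ) : ℝ≥0∞ :=
  essSup (fun x => ENNReal.ofReal (hnorm n x ^ α * |f x|)) volume

/-- `Ω_Q`: the volume of the Korányi unit ball. -/
noncomputable def ΩQ (n : ℕ) : ℝ :=
  (volume {x : Fin (2*n+1) → ℝ | hnorm n x < 1}).toReal


theorem hnorm_nonneg' (n : ℕ) (x : Fin (2*n+1) → ℝ) : 0 ≤ hnorm n x := by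
  unfold hnorm; positivity

theorem hnorm_meas (n : ℕ) : Measurable (hnorm n) := by
  unfold hnorm
  refine Measurable.pow_const (Measurable.add (Measurable.pow_const
    (Finset.measurable_sum _ fun i _ => ?_) 2) (by fun_prop)) _
  split_ifs <;> fun_prop

theorem hnorm_zero_imp (n : ℕ) (x : Fin (2*n+1) → ℝ) (h : hnorm n x = 0) : x = 0 := by
  unfold hnorm at h
  rw [Real.rpow_eq_zero (by positivity) (by norm_num)] at h
  have hs : 0 ≤ ∑ i : Fin (2*n+1), (if (i : ℕ) < 2*n then (x i)^2 else 0) :=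
    Finset.sum_nonneg fun i _ => by split_ifs <;> positivity
  have h2 : x (Fin.last (2*n)) = 0 := by
    have hsq := sq_nonneg (∑ i : Fin (2*n+1), (if (i : ℕ) < 2*n then (x i)^2 else 0))
    have hsq2 := sq_nonneg (x (Fin.last (2*n)))
    exact pow_eq_zero_iff (two_ne_zero) |>.1 (by linarith)
  have h1 : ∑ i : Fin (2*n+1), (if (i : ℕ) < 2*n then (x i)^2 else 0) = 0 := by
    rw [h2] at h; simpa using h
  rw [Finset.sum_eq_zero_iff_of_nonneg (fun i _ => by split_ifs <;> positivity)] at h1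
  funext i
  by_cases hi : (i : ℕ) < 2*n
  · have := h1 i (Finset.mem_univ _)
    rw [if_pos hi] at this
    simpa using this
  · have : i = Fin.last (2*n) := by
      apply Fin.ext; simp; omega
    rw [this, h2]; rfl

theorem hnorm_ae_pos (n : ℕ) : ∀ᵐ x : Fin (2*n+1) → ℝ, 0 < hnorm n x := by
  have : ∀ᵐ x : Fin (2*n+1) → ℝ, x ≠ 0 := by
    rw [ae_iff]; simp
  filter_upwards [this] with x hx
  exact lt_of_le_of_ne (hnorm_nonneg' n x) fun h => hx (hnorm_zero_imp n x h.symm)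

theorem hnorm_dil' (n : ℕ) (r : ℝ) (hr : 0 < r) (x : Fin (2*n+1) → ℝ) :
    hnorm n (dil n r x) = r * hnorm n x := by
  unfold hnorm dil
  have h1 : ∀ i : Fin (2*n+1), (if (i : ℕ) < 2*n then
      (if (i : ℕ) < 2*n then r * x i else r^2 * x i)^2 else 0) =
      r^2 * (if (i : ℕ) < 2*n then (x i)^2 else 0) := by
    intro i; split_ifs <;> ring
  simp only [h1, ← Finset.mul_sum]
  have h2 : ((r^2 * ∑ i : Fin (2*n+1), (if (i : ℕ) < 2*n then (x i)^2 else 0))^2 +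
      (if ((Fin.last (2*n) : Fin (2*n+1)) : ℕ) < 2*n then r * x (Fin.last (2*n))
        else r^2 * x (Fin.last (2*n)))^2) =
      r^4 * ((∑ i : Fin (2*n+1), (if (i : ℕ) < 2*n then (x i)^2 else 0))^2
        + x (Fin.last (2*n))^2) := by
    rw [if_neg (by simp)]; ring
  rw [h2, Real.mul_rpow (by positivity) (by positivity)]
  congr 1
  rw [← Real.rpow_natCast, ← Real.rpow_mul hr.le]
  norm_num

/-- dilation as a linear map -/
noncomputable def dilL (n : ℕ) (r : ℝ) : (Fin (2*n+1) → ℝ) →ₗ[ℝ] (Fin (2*n+1) → ℝ) :=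
  Matrix.toLin' (Matrix.diagonal fun i : Fin (2*n+1) => if (i : ℕ) < 2*n then r else r^2)

theorem dilL_apply (n : ℕ) (r : ℝ) (x) : dilL n r x = dil n r x := by
  funext i
  simp only [dilL, Matrix.toLin'_apply, Matrix.mulVec_diagonal, dil]
  split_ifs <;> rfl

theorem dilL_det (n : ℕ) (r : ℝ) : LinearMap.det (dilL n r) = r^(2*n+2) := by
  rw [dilL, LinearMap.det_toLin', Matrix.det_diagonal, Fin.prod_univ_castSucc]
  simp
  ring

noncomputable def dilM (n m : ℕ) (r : ℝ) :
    (Fin m → Fin (2*n+1) → ℝ) →ₗ[ℝ] (Fin m → Fin (2*n+1) → ℝ) :=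
  LinearMap.pi fun i => (dilL n r).comp (LinearMap.proj i)

theorem dilM_apply (n m : ℕ) (r : ℝ) (y) (i : Fin m) : dilM n m r y i = dil n r (y i) := by
  simp [dilM, dilL_apply]

theorem dilM_det (n m : ℕ) (r : ℝ) : LinearMap.det (dilM n m r) = (r^(2*n+2))^m := by
  rw [dilM, LinearMap.det_pi]
  simp [dilL_det]

theorem dilM_map (n m : ℕ) (r : ℝ) (hr : 0 < r) :
    Measure.map (dilM n m r) (volume : Measure (Fin m → Fin (2*n+1) → ℝ)) =
      ENNReal.ofReal (((r^(2*n+2))^m)⁻¹) • volume := by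
  rw [Measure.map_linearMap_addHaar_eq_smul_addHaar _ (by rw [dilM_det]; positivity),
    dilM_det, abs_of_pos (by positivity)]

/-- region -/
def reg (n m : ℕ) (r : ℝ) : Set (Fin m → Fin (2*n+1) → ℝ) :=
  {y | Real.sqrt (∑ i, hnorm n (y i) ^ 2) < r}

theorem reg_meas (n m : ℕ) (r : ℝ) : MeasurableSet (reg n m r) := by
  refine measurableSet_lt (Measurable.sqrt (Finset.measurable_sum _ fun i _ =>
    Measurable.pow_const ((hnorm_meas n).comp (measurable_pi_apply i)) 2)) measurable_const

noncomputable def ker (n m : ℕ) (α : Fin m → ℝ) (y : Fin m → Fin (2*n+1) → ℝ) : ℝ :=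
  ∏ i, hnorm n (y i) ^ (-(α i))

theorem ker_meas (n m : ℕ) (α : Fin m → ℝ) : Measurable (ker n m α) := by
  refine Finset.measurable_prod _ fun i _ =>
    Measurable.pow_const ((hnorm_meas n).comp (measurable_pi_apply i)) _

theorem ind_comp (n m : ℕ) (α : Fin m → ℝ) (r : ℝ) (hr : 0 < r) (z) :
    (reg n m r).indicator (ker n m α) (dilM n m r z) =
      r ^ (-(∑ i, α i)) * (reg n m 1).indicator (ker n m α) z := by
  have h1 : dilM n m r z ∈ reg n m r ↔ z ∈ reg n m 1 := by
    simp only [reg, Set.mem_ofPred_eq, dilM_apply, hnorm_dil' n r hr, mul_pow, ← Finset.mul_sum]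
    rw [Real.sqrt_mul (by positivity), Real.sqrt_sq hr.le]
    constructor
    · intro h; by_contra h'; push Not at h'; nlinarith
    · intro h; nlinarith
  by_cases hz : z ∈ reg n m 1
  · rw [Set.indicator_of_mem hz, Set.indicator_of_mem (h1.2 hz)]
    simp only [ker, dilM_apply, hnorm_dil' n r hr]
    rw [← Finset.sum_neg_distrib, Real.rpow_sum_of_pos hr, ← Finset.prod_mul_distrib]
    exact Finset.prod_congr rfl fun i _ => Real.mul_rpow hr.le (hnorm_nonneg' n _)
  · rw [Set.indicator_of_notMem hz, Set.indicator_of_notMem (fun h => hz (h1.1 h)), mul_zero]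

theorem scaling (n m : ℕ) (α : Fin m → ℝ) (r : ℝ) (hr : 0 < r)
    (hI : IntegrableOn (ker n m α) (reg n m 1)) :
    IntegrableOn (ker n m α) (reg n m r) ∧
    ∫ y in reg n m r, ker n m α y =
      (r^(2*n+2))^m * r ^ (-(∑ i, α i)) * ∫ y in reg n m 1, ker n m α y := by
  have hD : Measurable (dilM n m r) :=
    (LinearMap.continuous_of_finiteDimensional (dilM n m r)).measurable
  have hF : Measurable ((reg n m r).indicator (ker n m α)) :=
    (ker_meas n m α).indicator (reg_meas n m r)
  have hp : 0 < (r^(2*n+2))^m := by positivity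
  have hmap := dilM_map n m r hr
  have hcomp : (reg n m r).indicator (ker n m α) ∘ dilM n m r =
      fun z => r ^ (-(∑ i, α i)) * (reg n m 1).indicator (ker n m α) z := by
    funext z; exact ind_comp n m α r hr z
  constructor
  · rw [← integrable_indicator_iff (reg_meas n m r)]
    rw [← integrable_indicator_iff (reg_meas n m 1)] at hI
    have h1 : Integrable ((reg n m r).indicator (ker n m α))
        (Measure.map (dilM n m r) volume) := by
      rw [integrable_map_measure hF.aestronglyMeasurable hD.aemeasurable, hcomp]
      exact hI.const_mul _
    rw [hmap] at h1
    rwa [integrable_smul_measure (by simpa using hp) ENNReal.ofReal_ne_top] at h1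
  · rw [← integral_indicator (reg_meas n m r), ← integral_indicator (reg_meas n m 1)]
    have h1 := integral_map (μ := volume) hD.aemeasurable
      (f := (reg n m r).indicator (ker n m α)) hF.aestronglyMeasurable
    rw [hmap, integral_smul_measure, ENNReal.toReal_ofReal (by positivity)] at h1
    have h2 : ∀ z, (reg n m r).indicator (ker n m α) (dilM n m r z) =
      r ^ (-(∑ i, α i)) * (reg n m 1).indicator (ker n m α) z := ind_comp n m α r hr
    simp only [h2, integral_const_mul, smul_eq_mul] at h1
    rw [mul_assoc, ← h1, mul_inv_cancel_left₀ hp.ne']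

theorem ker_nonneg (n m : ℕ) (α : Fin m → ℝ) (y) : 0 ≤ ker n m α y :=
  Finset.prod_nonneg fun i _ => Real.rpow_nonneg (hnorm_nonneg' n _) _

/-- algebra of exponents -/
theorem cancel (n m : ℕ) (Q : ℝ) (hQ : Q = 2*n+2) (a r W I : ℝ) (hr : 0 < r) :
    r ^ a * (W * (r ^ ((m:ℝ) * Q))⁻¹ * ((r^(2*n+2))^m * r ^ (-a) * I)) = W * I := by
  have h1 : r ^ ((m:ℝ) * Q) = (r^(2*n+2))^m := by
    rw [← pow_mul, ← Real.rpow_natCast]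
    congr 1; rw [hQ]; push_cast; ring
  have hp : (r^(2*n+2))^m ≠ 0 := by positivity
  have ha : r ^ a ≠ 0 := by positivity
  rw [h1, Real.rpow_neg hr.le]
  field_simp

/-- the operator norm of the `m`-linear Hardy operator on the Heisenberg
group from `H^∞_{α₁} × ⋯ × H^∞_{α_m}` to `H^∞_α` is exactly `𝒜_m^h`, i.e. `𝒜_m^h`
is the least admissible constant. -/
theorem statement4 (n : ℕ) (hn : 1 ≤ n) (m : ℕ) (hm : 1 ≤ m)
    (α : Fin m → ℝ) (hα : ∀ i, 0 < α i)
    (Q : ℝ) (hQ : Q = 2*n+2)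
    (A : ℝ)
    (hA : A = (ΩQ n ^ m)⁻¹ *
      ∫ y in {y : Fin m → Fin (2*n+1) → ℝ | Real.sqrt (∑ i, hnorm n (y i) ^ 2) < 1},
        ∏ i, hnorm n (y i) ^ (-(α i)))
    (hAfin : IntegrableOn (fun y : Fin m → Fin (2*n+1) → ℝ => ∏ i, hnorm n (y i) ^ (-(α i)))
      {y : Fin m → Fin (2*n+1) → ℝ | Real.sqrt (∑ i, hnorm n (y i) ^ 2) < 1}) :
    IsLeast {C : ℝ≥0∞ | ∀ f : Fin m → (Fin (2*n+1) → ℝ) → ℝ,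
        (∀ i, Measurable (f i)) → (∀ i, ∀ y, 0 ≤ f i y) →
        (∀ i, wnorm n (α i) (f i) < ⊤) →
        wnorm n (∑ i, α i)
            (fun x => (ΩQ n ^ m)⁻¹ * (hnorm n x ^ ((m : ℝ) * Q))⁻¹ *
              ∫ y in {y : Fin m → Fin (2*n+1) → ℝ |
                  Real.sqrt (∑ i, hnorm n (y i) ^ 2) < hnorm n x},
                ∏ i, f i (y i))
          ≤ C * ∏ i, wnorm n (α i) (f i)} (ENNReal.ofReal A) := by
  have hA' : A = (ΩQ n ^ m)⁻¹ * ∫ y in reg n m 1, ker n m α y := hA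
  have hI : IntegrableOn (ker n m α) (reg n m 1) := hAfin
  have hΩ : 0 ≤ (ΩQ n ^ m)⁻¹ := by
    have : 0 ≤ ΩQ n := ENNReal.toReal_nonneg
    positivity
  have hI0 : 0 ≤ ∫ y in reg n m 1, ker n m α y := integral_nonneg fun y => ker_nonneg n m α y
  have hA0 : 0 ≤ A := by rw [hA']; positivity
  constructor
  · intro f hf hf0 hfin
    set c : Fin m → ℝ := fun i => (wnorm n (α i) (f i)).toReal with hc
    have hc0 : ∀ i, 0 ≤ c i := fun i => ENNReal.toReal_nonneg
    have hcw : ENNReal.ofReal A * ∏ i, wnorm n (α i) (f i) = ENNReal.ofReal (A * ∏ i, c i) := by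
      rw [ENNReal.ofReal_mul hA0, ENNReal.ofReal_prod_of_nonneg fun i _ => hc0 i]
      congr 1
      exact Finset.prod_congr rfl fun i _ => (ENNReal.ofReal_toReal (hfin i).ne).symm
    have hb : ∀ i, ∀ᵐ x : Fin (2*n+1) → ℝ, f i x ≤ c i * hnorm n x ^ (-(α i)) := by
      intro i
      filter_upwards [hnorm_ae_pos n, ENNReal.ae_le_essSup (μ := volume)
        (fun x => ENNReal.ofReal (hnorm n x ^ (α i) * |f i x|))] with x hx hle
      have h1 : hnorm n x ^ (α i) * |f i x| ≤ c i :=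
        (ENNReal.ofReal_le_iff_le_toReal (hfin i).ne).1 hle
      rw [abs_of_nonneg (hf0 i x)] at h1
      have hp : 0 < hnorm n x ^ (α i) := Real.rpow_pos_of_pos hx _
      rw [Real.rpow_neg hx.le, ← div_eq_mul_inv, le_div_iff₀ hp, mul_comm]
      exact h1
    have hb' : ∀ᵐ y : Fin m → Fin (2*n+1) → ℝ,
        ∏ i, f i (y i) ≤ (∏ i, c i) * ker n m α y := by
      have : ∀ᵐ y : Fin m → Fin (2*n+1) → ℝ, ∀ i,
          f i (y i) ≤ c i * hnorm n (y i) ^ (-(α i)) :=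
        Filter.eventually_all.2 fun i =>
          (Measure.tendsto_eval_ae_ae (μ := fun _ : Fin m =>
            (volume : Measure (Fin (2*n+1) → ℝ))) (i := i)).eventually (hb i)
      filter_upwards [this] with y hy
      rw [ker, ← Finset.prod_mul_distrib]
      exact Finset.prod_le_prod (fun i _ => hf0 i _) fun i _ => hy i
    rw [hcw]
    refine essSup_le_of_ae_le _ ?_
    filter_upwards [hnorm_ae_pos n] with x hx
    apply ENNReal.ofReal_le_ofReal
    obtain ⟨hs1, hs2⟩ := scaling n m α (hnorm n x) hx hI
    have hle : ∫ y in reg n m (hnorm n x), ∏ i, f i (y i) ≤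
        ∫ y in reg n m (hnorm n x), (∏ i, c i) * ker n m α y :=
      integral_mono_of_nonneg (Filter.Eventually.of_forall fun y =>
        Finset.prod_nonneg fun i _ => hf0 i _) (hs1.const_mul _) (ae_restrict_of_ae hb')
    have hnn : 0 ≤ ∫ y in reg n m (hnorm n x), ∏ i, f i (y i) :=
      integral_nonneg fun y => Finset.prod_nonneg fun i _ => hf0 i _
    have hpos : 0 ≤ (ΩQ n ^ m)⁻¹ * (hnorm n x ^ ((m : ℝ) * Q))⁻¹ := by
      have := Real.rpow_nonneg hx.le ((m : ℝ) * Q)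
      positivity
    change hnorm n x ^ (∑ i, α i) * |(ΩQ n ^ m)⁻¹ * (hnorm n x ^ ((m : ℝ) * Q))⁻¹ *
      ∫ y in reg n m (hnorm n x), ∏ i, f i (y i)| ≤ A * ∏ i, c i
    rw [abs_of_nonneg (mul_nonneg hpos hnn)]
    rw [integral_const_mul, hs2] at hle
    calc _ ≤ hnorm n x ^ (∑ i, α i) * ((ΩQ n ^ m)⁻¹ * (hnorm n x ^ ((m : ℝ) * Q))⁻¹ * _) :=
          mul_le_mul_of_nonneg_left (mul_le_mul_of_nonneg_left hle hpos)
            (Real.rpow_nonneg hx.le _)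
      _ = (hnorm n x ^ (∑ i, α i) * ((ΩQ n ^ m)⁻¹ * (hnorm n x ^ ((m : ℝ) * Q))⁻¹ *
          ((hnorm n x ^(2*n+2))^m * hnorm n x ^ (-(∑ i, α i)) *
            ∫ y in reg n m 1, ker n m α y))) * ∏ i, c i := by ring
      _ = A * ∏ i, c i := by rw [cancel n m Q hQ _ _ _ _ hx, hA']
  · intro C hC
    have hw : ∀ i, wnorm n (α i) (fun x => hnorm n x ^ (-(α i))) ≤ 1 := by
      intro i
      refine essSup_le_of_ae_le _ ?_
      filter_upwards [hnorm_ae_pos n] with x hx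
      rw [abs_of_nonneg (Real.rpow_nonneg hx.le _), ← Real.rpow_add hx]
      simp
    have h := hC (fun i x => hnorm n x ^ (-(α i))) (fun i => (hnorm_meas n).pow_const _)
      (fun i y => Real.rpow_nonneg (hnorm_nonneg' n y) _)
      (fun i => (hw i).trans_lt ENNReal.one_lt_top)
    have h2 : wnorm n (∑ i, α i)
            (fun x => (ΩQ n ^ m)⁻¹ * (hnorm n x ^ ((m : ℝ) * Q))⁻¹ *
              ∫ y in reg n m (hnorm n x), ker n m α y) = ENNReal.ofReal A := by
      have h3 : (fun x => ENNReal.ofReal (hnorm n x ^ (∑ i, α i) *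
          |(ΩQ n ^ m)⁻¹ * (hnorm n x ^ ((m : ℝ) * Q))⁻¹ *
              ∫ y in reg n m (hnorm n x), ker n m α y|)) =ᵐ[volume]
          fun _ => ENNReal.ofReal A := by
        filter_upwards [hnorm_ae_pos n] with x hx
        have hnn : 0 ≤ ∫ y in reg n m (hnorm n x), ker n m α y :=
          integral_nonneg fun y => ker_nonneg n m α y
        have hpos : 0 ≤ (ΩQ n ^ m)⁻¹ * (hnorm n x ^ ((m : ℝ) * Q))⁻¹ := by
          have := Real.rpow_nonneg hx.le ((m : ℝ) * Q)
          positivity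
        rw [abs_of_nonneg (mul_nonneg hpos hnn), (scaling n m α (hnorm n x) hx hI).2,
          cancel n m Q hQ _ _ _ _ hx, hA']
      rw [wnorm, essSup_congr_ae h3, essSup_const _ (NeZero.ne _)]
    calc ENNReal.ofReal A = _ := h2.symm
      _ ≤ C * ∏ i, wnorm n (α i) (fun x => hnorm n x ^ (-(α i))) := h
      _ ≤ C * 1 := by
        gcongr
        exact Finset.prod_le_one' fun i _ => hw i
      _ = C := mul_one C
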